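/- Let GG be a triple graph grammar with plain monotonic rules whose start graph is the empty triple graph. Then a triple graph G = (G_S ← G_C → G_T) belongs to L(GG) if and only if there exists a transformation sequence G_0 ⇒_{r_1^F,m_1} … ⇒_{r_t^F,m_t} G_t via forward rules of rules of GG such that G_0 = (G_S ← ∅ → ∅), G_t = (G_S ← G_C → G_T), and the sequence is consistently and entirely marking. -/

import Mathlib

/-!
Set-theoretic formalization of (partial) triple graphs, triple graph grammars (TGGs),
their operationalizations and short-cut rules, following
Fritsche, Kosiol, Schürr, Taentzer: "Avoiding Unnecessary Information Loss".

A graph is given by a set of node names and a set of edges, where an edge is a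
name together with its source and target node (this encodes the source and
target functions).  Subgraphs, unions, intersections and differences are plain
set-theoretic operations.  Correspondence morphisms of (partial) triple graphs
are encoded as functional relations; a *triple graph* in the strict sense is a
`Total` one, a general inhabitant of `Triple` is a *partial triple graph*.
-/

namespace TGGPaper

structure Graph (V E : Type) where
  verts : Set V
  edges : Set (E × V × V)

namespace Graph

variable {V E : Type}

/-- The set of edge names occurring in `G`. -/
def edgeNames (G : Graph V E) : Set E := {e | ∃ u w, (e, u, w) ∈ G.edges}

/-- Well-formedness: endpoints of edges are nodes of the graph, and an edge
name determines its source and target node. -/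
def WF (G : Graph V E) : Prop :=
  (∀ x ∈ G.edges, x.2.1 ∈ G.verts ∧ x.2.2 ∈ G.verts) ∧
  (∀ x ∈ G.edges, ∀ y ∈ G.edges, x.1 = y.1 → x = y)

/-- Subgraph relation. -/
def Sub (H G : Graph V E) : Prop := H.verts ⊆ G.verts ∧ H.edges ⊆ G.edges

/-- The empty graph. -/
def emptyG (V E : Type) : Graph V E := ⟨∅, ∅⟩

/-- Finiteness of a graph. -/
def IsFinite (G : Graph V E) : Prop := G.verts.Finite ∧ G.edges.Finite

end Graph

/-- The data of a graph morphism: functions on node names and edge names. -/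
structure GMap (V E : Type) where
  onV : V → V
  onE : E → E

namespace GMap

variable {V E : Type}

/-- The induced action on edges. -/
def onEdge (f : GMap V E) (x : E × V × V) : E × V × V :=
  (f.onE x.1, f.onV x.2.1, f.onV x.2.2)

/-- `f` is a graph morphism from `G` to `H` (preservation of sources and
targets of edges is built into the action on edges). -/
def IsHom (f : GMap V E) (G H : Graph V E) : Prop :=
  (∀ v ∈ G.verts, f.onV v ∈ H.verts) ∧ (∀ x ∈ G.edges, f.onEdge x ∈ H.edges)

/-- `f` is injective on `G`. -/
def InjOn (f : GMap V E) (G : Graph V E) : Prop :=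
  Set.InjOn f.onV G.verts ∧ Set.InjOn f.onE G.edgeNames

end GMap

/-- A (partial) triple graph: source, correspondence and target graph together
with the correspondence morphisms `σ` (towards source) and `τ` (towards
target), encoded as functional relations on node and edge names.  Triple
graphs in the strict sense are the `Total` ones. -/
structure Triple (V E : Type) where
  S : Graph V E
  C : Graph V E
  T : Graph V E
  σV : Set (V × V)
  σE : Set (E × E)
  τV : Set (V × V)
  τE : Set (E × E)

namespace Triple

variable {V E : Type}

/-- Well-formedness of one correspondence morphism (as a possibly partial
graph morphism from `C` to `S`, given by relations `rV` on nodes and `rE` on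
edge names): it is functional, defined on a subgraph of `C` (its domain), maps
into `S` and commutes with sources and targets. -/
def CorrWF (C S : Graph V E) (rV : Set (V × V)) (rE : Set (E × E)) : Prop :=
  (∀ p ∈ rV, p.1 ∈ C.verts ∧ p.2 ∈ S.verts) ∧
  (∀ p ∈ rV, ∀ q ∈ rV, p.1 = q.1 → p = q) ∧
  (∀ p ∈ rE, ∀ q ∈ rE, p.1 = q.1 → p = q) ∧
  (∀ p ∈ rE, ∀ u w, (p.1, u, w) ∈ C.edges →
    ∃ u' w', (p.2, u', w') ∈ S.edges ∧ (u, u') ∈ rV ∧ (w, w') ∈ rV) ∧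
  (∀ p ∈ rE, p.1 ∈ C.edgeNames)

def WF (G : Triple V E) : Prop :=
  G.S.WF ∧ G.C.WF ∧ G.T.WF ∧ CorrWF G.C G.S G.σV G.σE ∧ CorrWF G.C G.T G.τV G.τE

/-- Totality of both correspondence morphisms: `G` is a triple graph in the
strict sense (not a properly partial one). -/
def Total (G : Triple V E) : Prop :=
  (∀ c ∈ G.C.verts, ∃ s, (c, s) ∈ G.σV) ∧ (∀ e ∈ G.C.edgeNames, ∃ e', (e, e') ∈ G.σE) ∧
  (∀ c ∈ G.C.verts, ∃ s, (c, s) ∈ G.τV) ∧ (∀ e ∈ G.C.edgeNames, ∃ e', (e, e') ∈ G.τE)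

/-- Sub-triple-graph relation. -/
def Sub (H G : Triple V E) : Prop :=
  H.S.Sub G.S ∧ H.C.Sub G.C ∧ H.T.Sub G.T ∧
  H.σV ⊆ G.σV ∧ H.σE ⊆ G.σE ∧ H.τV ⊆ G.τV ∧ H.τE ⊆ G.τE

/-- The empty triple graph. -/
def IsEmptyTriple (G : Triple V E) : Prop :=
  G.S = Graph.emptyG V E ∧ G.C = Graph.emptyG V E ∧ G.T = Graph.emptyG V E ∧
  G.σV = ∅ ∧ G.σE = ∅ ∧ G.τV = ∅ ∧ G.τE = ∅

/-- Finiteness of a triple graph. -/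
def IsFinite (G : Triple V E) : Prop :=
  G.S.IsFinite ∧ G.C.IsFinite ∧ G.T.IsFinite ∧
  G.σV.Finite ∧ G.σE.Finite ∧ G.τV.Finite ∧ G.τE.Finite

/-- The triple graph `(G_S ← ∅ → ∅)`. -/
def srcOnly (G : Triple V E) : Triple V E :=
  ⟨G.S, Graph.emptyG V E, Graph.emptyG V E, ∅, ∅, ∅, ∅⟩

/-- Replace the source graph of `X` by `HS` and restrict the correspondence
morphism `σ` to those elements that still have an image: the partial triple
graph `(HS ⇠ X_C → X_T)` induced by an edit of the source graph. -/
def withSource (X : Triple V E) (HS : Graph V E) : Triple V E :=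
  ⟨HS, X.C, X.T,
   {q ∈ X.σV | q.2 ∈ HS.verts}, {q ∈ X.σE | q.2 ∈ HS.edgeNames},
   X.τV, X.τE⟩

/-- Componentwise union of triple graphs (used for the union of two triple
graphs along a common subgraph). -/
def union (G1 G2 : Triple V E) : Triple V E :=
  ⟨⟨G1.S.verts ∪ G2.S.verts, G1.S.edges ∪ G2.S.edges⟩,
   ⟨G1.C.verts ∪ G2.C.verts, G1.C.edges ∪ G2.C.edges⟩,
   ⟨G1.T.verts ∪ G2.T.verts, G1.T.edges ∪ G2.T.edges⟩,
   G1.σV ∪ G2.σV, G1.σE ∪ G2.σE, G1.τV ∪ G2.τV, G1.τE ∪ G2.τE⟩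

/-- `S` is componentwise the intersection of `G1` and `G2` — the standing
assumption `G1 ∩ G2 = S` when forming the union of `G1` and `G2` along `S`. -/
def MeetIn (G1 G2 S : Triple V E) : Prop :=
  G1.S.verts ∩ G2.S.verts = S.S.verts ∧ G1.S.edges ∩ G2.S.edges = S.S.edges ∧
  G1.C.verts ∩ G2.C.verts = S.C.verts ∧ G1.C.edges ∩ G2.C.edges = S.C.edges ∧
  G1.T.verts ∩ G2.T.verts = S.T.verts ∧ G1.T.edges ∩ G2.T.edges = S.T.edges ∧
  G1.σV ∩ G2.σV = S.σV ∧ G1.σE ∩ G2.σE = S.σE ∧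
  G1.τV ∩ G2.τV = S.τV ∧ G1.τE ∩ G2.τE = S.τE

end Triple

/-- The data of a triple graph morphism. -/
structure TMap (V E : Type) where
  fS : GMap V E
  fC : GMap V E
  fT : GMap V E

namespace TMap

variable {V E : Type}

/-- `f` is a morphism of (partial) triple graphs from `G` to `H`:
componentwise a graph morphism that maps the domains of the correspondence
morphisms into the corresponding domains and commutes with them there. -/
def IsHom (f : TMap V E) (G H : Triple V E) : Prop :=
  f.fS.IsHom G.S H.S ∧ f.fC.IsHom G.C H.C ∧ f.fT.IsHom G.T H.T ∧
  (∀ p ∈ G.σV, (f.fC.onV p.1, f.fS.onV p.2) ∈ H.σV) ∧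
  (∀ p ∈ G.σE, (f.fC.onE p.1, f.fS.onE p.2) ∈ H.σE) ∧
  (∀ p ∈ G.τV, (f.fC.onV p.1, f.fT.onV p.2) ∈ H.τV) ∧
  (∀ p ∈ G.τE, (f.fC.onE p.1, f.fT.onE p.2) ∈ H.τE)

/-- `f` is injective on `G` (componentwise). -/
def InjOn (f : TMap V E) (G : Triple V E) : Prop :=
  f.fS.InjOn G.S ∧ f.fC.InjOn G.C ∧ f.fT.InjOn G.T

/-- `f` and `g` agree on (all elements of) `X`, i.e. they match the same
elements when `X` is their common domain of definition. -/
def EqOn (f g : TMap V E) (X : Triple V E) : Prop :=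
  (∀ v ∈ X.S.verts, f.fS.onV v = g.fS.onV v) ∧ (∀ e ∈ X.S.edgeNames, f.fS.onE e = g.fS.onE e) ∧
  (∀ v ∈ X.C.verts, f.fC.onV v = g.fC.onV v) ∧ (∀ e ∈ X.C.edgeNames, f.fC.onE e = g.fC.onE e) ∧
  (∀ v ∈ X.T.verts, f.fT.onV v = g.fT.onV v) ∧ (∀ e ∈ X.T.edgeNames, f.fT.onE e = g.fT.onE e)

end TMap

variable {V E : Type}

/-- Isomorphism of (partial) triple graphs. -/
def TIso (X Y : Triple V E) : Prop :=
  ∃ f : TMap V E, f.IsHom X Y ∧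
    Set.BijOn f.fS.onV X.S.verts Y.S.verts ∧ Set.BijOn f.fS.onEdge X.S.edges Y.S.edges ∧
    Set.BijOn f.fC.onV X.C.verts Y.C.verts ∧ Set.BijOn f.fC.onEdge X.C.edges Y.C.edges ∧
    Set.BijOn f.fT.onV X.T.verts Y.T.verts ∧ Set.BijOn f.fT.onEdge X.T.edges Y.T.edges ∧
    (∀ p ∈ Y.σV, ∃ q ∈ X.σV, (f.fC.onV q.1, f.fS.onV q.2) = p) ∧
    (∀ p ∈ Y.σE, ∃ q ∈ X.σE, (f.fC.onE q.1, f.fS.onE q.2) = p) ∧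
    (∀ p ∈ Y.τV, ∃ q ∈ X.τV, (f.fC.onV q.1, f.fT.onV q.2) = p) ∧
    (∀ p ∈ Y.τE, ∃ q ∈ X.τE, (f.fC.onE q.1, f.fT.onE q.2) = p)

/-- A rule `L ← K → R` on (partial) triple graphs; that `K` is a common
subgraph of `L` and `R` is part of `Rule.WF`. -/
structure Rule (V E : Type) where
  L : Triple V E
  K : Triple V E
  R : Triple V E

namespace Rule

variable {V E : Type}

def WF (p : Rule V E) : Prop :=
  p.L.WF ∧ p.K.WF ∧ p.R.WF ∧ p.K.Sub p.L ∧ p.K.Sub p.R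

/-- A triple rule in the strict sense: all three parts are total. -/
def TotalRule (p : Rule V E) : Prop := p.L.Total ∧ p.K.Total ∧ p.R.Total

/-- A rule is monotonic (non-deleting) if `K = L`. -/
def Monotonic (p : Rule V E) : Prop := p.K = p.L

/-- The inverse rule `R ← K → L`. -/
def inv (p : Rule V E) : Rule V E := ⟨p.R, p.K, p.L⟩

/-- The left-hand side `(R_S ← L_C → L_T)` of the forward rule of a monotonic
rule; its correspondence morphism towards the source is `σ_R ∘ r_C`. -/
def fwdL (p : Rule V E) : Triple V E :=
  { S := p.R.S, C := p.L.C, T := p.L.T,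
    σV := {q ∈ p.R.σV | q.1 ∈ p.L.C.verts},
    σE := {q ∈ p.R.σE | q.1 ∈ p.L.C.edgeNames},
    τV := p.L.τV, τE := p.L.τE }

/-- The forward rule `r^F : (R_S ← L_C → L_T) → (R_S ← R_C → R_T)` of a plain
monotonic triple rule (a monotonic rule, acting as the identity on the source
component). -/
def fwd (p : Rule V E) : Rule V E := ⟨p.fwdL, p.fwdL, p.R⟩

/-- The source rule `(L_S ← ∅ → ∅) ← (K_S ← ∅ → ∅) → (R_S ← ∅ → ∅)`. -/
def srcRule (p : Rule V E) : Rule V E := ⟨p.L.srcOnly, p.K.srcOnly, p.R.srcOnly⟩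

/-- The left-hand side `(R_{sc,S} ⇠ L_{sc,C} → L_{sc,T})` of the forward
(repair) rule of a short-cut rule, carrying the partial correspondence
morphism induced by that of `L_sc`. -/
def fwdSCL (p : Rule V E) : Triple V E :=
  { S := p.R.S, C := p.L.C, T := p.L.T,
    σV := {q ∈ p.L.σV | q.2 ∈ p.R.S.verts},
    σE := {q ∈ p.L.σE | q.2 ∈ p.R.S.edgeNames},
    τV := p.L.τV, τE := p.L.τE }

/-- The interface `(R_{sc,S} ← K_{sc,C} → K_{sc,T})` of the forward (repair)
rule of a short-cut rule. -/
def fwdSCK (p : Rule V E) : Triple V E :=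
  { S := p.R.S, C := p.K.C, T := p.K.T,
    σV := p.K.σV, σE := p.K.σE, τV := p.K.τV, τE := p.K.τE }

/-- The forward rule (repair rule) of a short-cut rule, a rule on partial
triple graphs whose source component is the identity on `R_{sc,S}`. -/
def fwdSC (p : Rule V E) : Rule V E := ⟨p.fwdSCL, p.fwdSCK, p.R⟩

end Rule

/-- One graph component of a transformation step: the match and the comatch
agree on `K`, the created elements `n(R \ K)` are fresh, and the result arises
from `G` by node- and edge-wise deletion of `m(L \ K)` and union with
`n(R \ K)`. -/
def GraphStep (Lg Kg Rg Gg Hg : Graph V E) (m n : GMap V E) : Prop :=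
  (∀ v ∈ Kg.verts, n.onV v = m.onV v) ∧
  (∀ e ∈ Kg.edgeNames, n.onE e = m.onE e) ∧
  (∀ v ∈ Rg.verts \ Kg.verts, n.onV v ∉ Gg.verts) ∧
  (∀ e ∈ Rg.edgeNames \ Kg.edgeNames, n.onE e ∉ Gg.edgeNames) ∧
  Hg.verts = (Gg.verts \ (m.onV '' (Lg.verts \ Kg.verts))) ∪ (n.onV '' (Rg.verts \ Kg.verts)) ∧
  Hg.edges = (Gg.edges \ (m.onEdge '' (Lg.edges \ Kg.edges))) ∪ (n.onEdge '' (Rg.edges \ Kg.edges))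

/-- Deletion and union for one of the correspondence relations; kept pairs are
restricted to the surviving elements (for rules on genuine triple graphs this
restriction is vacuous, for partial triple graphs it yields the induced
partial correspondence morphism). -/
def RelStep {α : Type} (Lr Kr Rr Gr Hr : Set (α × α)) (domH codH : Set α)
    (mc ms nc ns : α → α) : Prop :=
  Hr = ({q ∈ Gr \ ((fun q : α × α => (mc q.1, ms q.2)) '' (Lr \ Kr)) |
          q.1 ∈ domH ∧ q.2 ∈ codH}) ∪
       ((fun q : α × α => (nc q.1, ns q.2)) '' (Rr \ Kr))

/-- A transformation step `G ⇒_{p,m} H` with injective match `m` and comatch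
`n` (in particular, `p` is applicable at `m`, as the intermediate result is
again a (partial) triple graph, `H` being well-formed). -/
def IsStep (p : Rule V E) (G H : Triple V E) (m n : TMap V E) : Prop :=
  G.WF ∧ H.WF ∧
  m.IsHom p.L G ∧ m.InjOn p.L ∧ n.IsHom p.R H ∧ n.InjOn p.R ∧
  GraphStep p.L.S p.K.S p.R.S G.S H.S m.fS n.fS ∧
  GraphStep p.L.C p.K.C p.R.C G.C H.C m.fC n.fC ∧
  GraphStep p.L.T p.K.T p.R.T G.T H.T m.fT n.fT ∧
  RelStep p.L.σV p.K.σV p.R.σV G.σV H.σV H.C.verts H.S.verts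
    m.fC.onV m.fS.onV n.fC.onV n.fS.onV ∧
  RelStep p.L.σE p.K.σE p.R.σE G.σE H.σE H.C.edgeNames H.S.edgeNames
    m.fC.onE m.fS.onE n.fC.onE n.fS.onE ∧
  RelStep p.L.τV p.K.τV p.R.τV G.τV H.τV H.C.verts H.T.verts
    m.fC.onV m.fT.onV n.fC.onV n.fT.onV ∧
  RelStep p.L.τE p.K.τE p.R.τE G.τE H.τE H.C.edgeNames H.T.edgeNames
    m.fC.onE m.fT.onE n.fC.onE n.fT.onE

/-- A triple graph grammar: a set of (plain, monotonic) triple rules and a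
start triple graph. -/
structure TGG (V E : Type) where
  rules : Set (Rule V E)
  start : Triple V E

/-- The language of a TGG: all triple graphs reachable from the start graph by
transformation steps via rules of the grammar. -/
def TGG.lang (GG : TGG V E) : Set (Triple V E) :=
  {H | Relation.ReflTransGen
        (fun G G' => ∃ p ∈ GG.rules, ∃ m n : TMap V E, IsStep p G G' m n) GG.start H}

/-- The nodes marked by an application of the forward rule of `p` at match `m`:
the images of the source marking elements `R_S \ L_S`. -/
def markedV (p : Rule V E) (m : TMap V E) : Set V :=
  m.fS.onV '' (p.R.S.verts \ p.L.S.verts)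

/-- The edges marked by an application of the forward rule of `p` at match `m`. -/
def markedE (p : Rule V E) (m : TMap V E) : Set (E × V × V) :=
  m.fS.onEdge '' (p.R.S.edges \ p.L.S.edges)

/-- The images of the required elements (nodes of `L_S`). -/
def requiredV (p : Rule V E) (m : TMap V E) : Set V := m.fS.onV '' p.L.S.verts

/-- The images of the required elements (edges of `L_S`). -/
def requiredE (p : Rule V E) (m : TMap V E) : Set (E × V × V) := m.fS.onEdge '' p.L.S.edges

/-- A transformation sequence `G_0 ⇒ … ⇒ G_t` via the forward rules of the
rules `ps i` at matches `ms i` with comatches `ns i`. -/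
def FwdSequence (t : ℕ) (Gs : ℕ → Triple V E) (ps : ℕ → Rule V E)
    (ms ns : ℕ → TMap V E) : Prop :=
  ∀ i, i < t → IsStep (ps i).fwd (Gs i) (Gs (i + 1)) (ms i) (ns i)

/-- No two rule applications of the sequence mark the same element. -/
def CreationPreserving (t : ℕ) (ps : ℕ → Rule V E) (ms : ℕ → TMap V E) : Prop :=
  ∀ i j, i < t → j < t → i ≠ j →
    markedV (ps i) (ms i) ∩ markedV (ps j) (ms j) = ∅ ∧
    markedE (ps i) (ms i) ∩ markedE (ps j) (ms j) = ∅

/-- All required elements of each rule application have been marked by a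
previous rule application of the sequence. -/
def ContextPreserving (t : ℕ) (ps : ℕ → Rule V E) (ms : ℕ → TMap V E) : Prop :=
  ∀ i, i < t →
    (∀ v ∈ requiredV (ps i) (ms i), ∃ k, k < i ∧ v ∈ markedV (ps k) (ms k)) ∧
    (∀ e ∈ requiredE (ps i) (ms i), ∃ k, k < i ∧ e ∈ markedE (ps k) (ms k))

def ConsistentlyMarking (t : ℕ) (ps : ℕ → Rule V E) (ms : ℕ → TMap V E) : Prop :=
  CreationPreserving t ps ms ∧ ContextPreserving t ps ms

/-- Every element of the common source graph `GS` is marked by some rule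
application of the sequence. -/
def EntirelyMarking (t : ℕ) (ps : ℕ → Rule V E) (ms : ℕ → TMap V E) (GS : Graph V E) : Prop :=
  (∀ v ∈ GS.verts, ∃ i, i < t ∧ v ∈ markedV (ps i) (ms i)) ∧
  (∀ e ∈ GS.edges, ∃ i, i < t ∧ e ∈ markedE (ps i) (ms i))

/-- A common kernel for the pair of monotonic rules `(r1, r2)`. -/
def IsCommonKernel (r1 r2 : Rule V E) (Lcap Rcap : Triple V E) : Prop :=
  Lcap.Sub r1.L ∧ Lcap.Sub r2.L ∧ Rcap.Sub r1.R ∧ Rcap.Sub r2.R ∧ Lcap.Sub Rcap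

/-- `rsc` is the short-cut rule of `(r1, r2)` (with `r1` applied inversely)
w.r.t. the common kernel `(Lcap, Rcap)`:
`L_sc = R_1 ∪_{L_1} L∪`, `K_sc = L∪ ∪_{L∩} R∩`, `R_sc = R_2 ∪_{L_2} L∪`,
where `L∪ = L_1 ∪_{L∩} L_2`, and the unions are taken along the respective
common subgraphs (whence the `MeetIn` assumptions). -/
def IsShortcutRule (r1 r2 : Rule V E) (Lcap Rcap : Triple V E) (rsc : Rule V E) : Prop :=
  IsCommonKernel r1 r2 Lcap Rcap ∧
  Triple.MeetIn r1.L r2.L Lcap ∧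
  Triple.MeetIn r1.R (r1.L.union r2.L) r1.L ∧
  Triple.MeetIn r2.R (r1.L.union r2.L) r2.L ∧
  Triple.MeetIn (r1.L.union r2.L) Rcap Lcap ∧
  rsc.L = r1.R.union (r1.L.union r2.L) ∧
  rsc.K = (r1.L.union r2.L).union Rcap ∧
  rsc.R = r2.R.union (r1.L.union r2.L)

/-- A set of negative application conditions for a rule with left-hand side
`L`: a finite set of (partial) triple graphs, each containing `L`. -/
def IsNACSet (L : Triple V E) (N : Set (Triple V E)) : Prop :=
  N.Finite ∧ ∀ X ∈ N, L.Sub X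

/-- An (injective) match `m : L → G` satisfies the NAC set `N` if for no
`X ∈ N` there is an injective morphism `X → G` restricting to `m` on `L`. -/
def SatisfiesNACs (L : Triple V E) (N : Set (Triple V E)) (G : Triple V E)
    (m : TMap V E) : Prop :=
  ∀ X ∈ N, ¬ ∃ x : TMap V E, x.IsHom X G ∧ x.InjOn X ∧ x.EqOn m L

/-- One graph component of sequential independence:
`n1(R1) ∩ m2(L2) ⊆ n1(K1) ∩ m2(K2)`. -/
def GIndep (R1 K1 L2 K2 : Graph V E) (n1 m2 : GMap V E) : Prop :=
  ((n1.onV '' R1.verts) ∩ (m2.onV '' L2.verts) ⊆ (n1.onV '' K1.verts) ∩ (m2.onV '' K2.verts)) ∧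
  ((n1.onEdge '' R1.edges) ∩ (m2.onEdge '' L2.edges) ⊆
    (n1.onEdge '' K1.edges) ∩ (m2.onEdge '' K2.edges))

/-- Sequential independence of two consecutive transformation steps via plain
rules `r1` and `r2`, where `n1` is the comatch of the first and `m2` the match
of the second step. -/
def SeqIndep (r1 r2 : Rule V E) (n1 m2 : TMap V E) : Prop :=
  GIndep r1.R.S r1.K.S r2.L.S r2.K.S n1.fS m2.fS ∧
  GIndep r1.R.C r1.K.C r2.L.C r2.K.C n1.fC m2.fC ∧
  GIndep r1.R.T r1.K.T r2.L.T r2.K.T n1.fT m2.fT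

def setS (X : Triple V E) (S : Graph V E) : Triple V E :=
  ⟨S, X.C, X.T, X.σV, X.σE, X.τV, X.τE⟩

instance : Inhabited (GMap V E) := ⟨⟨id, id⟩⟩
instance : Inhabited (TMap V E) := ⟨⟨default, default, default⟩⟩
instance : Inhabited (Graph V E) := ⟨⟨∅, ∅⟩⟩
instance : Inhabited (Triple V E) := ⟨⟨default, default, default, ∅, ∅, ∅, ∅⟩⟩
instance : Inhabited (Rule V E) := ⟨⟨default, default, default⟩⟩

theorem corr_cod {C S : Graph V E} {rV rE} (h : Triple.CorrWF C S rV rE) {q} (hq : q ∈ rE) :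
    q.1 ∈ C.edgeNames ∧ q.2 ∈ S.edgeNames := by
  obtain ⟨_, _, _, h4, h5⟩ := h
  refine ⟨h5 q hq, ?_⟩
  obtain ⟨u, w, hu⟩ := h5 q hq
  obtain ⟨u', w', h', -⟩ := h4 q hq u w hu
  exact ⟨u', w', h'⟩

theorem names_mono {G H : Graph V E} (h : G.edges ⊆ H.edges) : G.edgeNames ⊆ H.edgeNames :=
  fun _ ⟨u, w, hu⟩ => ⟨u, w, h hu⟩

theorem sub_trans {A B C : Graph V E} (h : A.Sub B) (h' : B.Sub C) : A.Sub C :=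
  ⟨h.1.trans h'.1, h.2.trans h'.2⟩

theorem corr_mono {C S S' : Graph V E} {rV rE} (h : Triple.CorrWF C S rV rE) (hs : S.Sub S') :
    Triple.CorrWF C S' rV rE := by
  obtain ⟨h1, h2, h3, h4, h5⟩ := h
  refine ⟨fun p hp => ⟨(h1 p hp).1, hs.1 (h1 p hp).2⟩, h2, h3, fun p hp u w hu => ?_, h5⟩
  obtain ⟨u', w', a, b⟩ := h4 p hp u w hu
  exact ⟨u', w', hs.2 a, b⟩

theorem relStep_iff {α : Type} {Lr Rr Gr Hr : Set (α × α)} {domH codH : Set α}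
    {mc ms nc ns : α → α} (h : ∀ q ∈ Gr, q.1 ∈ domH ∧ q.2 ∈ codH) :
    RelStep Lr Lr Rr Gr Hr domH codH mc ms nc ns ↔
      Hr = Gr ∪ ((fun q : α × α => (nc q.1, ns q.2)) '' (Rr \ Lr)) := by
  have : ({q ∈ Gr \ ((fun q : α × α => (mc q.1, ms q.2)) '' (Lr \ Lr)) |
          q.1 ∈ domH ∧ q.2 ∈ codH}) = Gr := by
    ext q; simp; exact ⟨fun a => a.1.1, fun hq => ⟨⟨hq, (h _ hq).1⟩, hq, (h _ hq).2⟩⟩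
  unfold RelStep
  rw [this]

theorem graphStep_iff {Lg Rg Gg Hg : Graph V E} {m n : GMap V E} :
    GraphStep Lg Lg Rg Gg Hg m n ↔
  (∀ v ∈ Lg.verts, n.onV v = m.onV v) ∧
  (∀ e ∈ Lg.edgeNames, n.onE e = m.onE e) ∧
  (∀ v ∈ Rg.verts \ Lg.verts, n.onV v ∉ Gg.verts) ∧
  (∀ e ∈ Rg.edgeNames \ Lg.edgeNames, n.onE e ∉ Gg.edgeNames) ∧
  Hg.verts = Gg.verts ∪ (n.onV '' (Rg.verts \ Lg.verts)) ∧
  Hg.edges = Gg.edges ∪ (n.onEdge '' (Rg.edges \ Lg.edges)) := by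
  simp [GraphStep]

theorem fwdL_σV {p : Rule V E} (hw : p.WF) (ht : p.TotalRule) (hm : p.Monotonic) :
    {q ∈ p.R.σV | q.1 ∈ p.L.C.verts} = p.L.σV := by
  obtain ⟨L, K, R⟩ := p
  cases hm
  obtain ⟨hL, -, hR, -, hs⟩ := hw
  ext q
  constructor
  · rintro ⟨hq, hc⟩
    obtain ⟨s, h⟩ := ht.1.1 _ hc
    have := hR.2.2.2.1.2.1 _ hq _ (hs.2.2.2.1 h) rfl
    rw [this]; exact h
  · exact fun hq => ⟨hs.2.2.2.1 hq, (hL.2.2.2.1.1 _ hq).1⟩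

theorem fwdL_σE {p : Rule V E} (hw : p.WF) (ht : p.TotalRule) (hm : p.Monotonic) :
    {q ∈ p.R.σE | q.1 ∈ p.L.C.edgeNames} = p.L.σE := by
  obtain ⟨L, K, R⟩ := p
  cases hm
  obtain ⟨hL, -, hR, -, hs⟩ := hw
  ext q
  constructor
  · rintro ⟨hq, hc⟩
    obtain ⟨s, h⟩ := ht.1.2.1 _ hc
    have := hR.2.2.2.1.2.2.1 _ hq _ (hs.2.2.2.2.1 h) rfl
    rw [this]; exact h
  · exact fun hq => ⟨hs.2.2.2.2.1 hq, (corr_cod hL.2.2.2.1 hq).1⟩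

theorem fwd_eq {p : Rule V E} (hw : p.WF) (ht : p.TotalRule) (hm : p.Monotonic) :
    p.fwd = ⟨setS p.L p.R.S, setS p.L p.R.S, p.R⟩ := by
  have : p.fwdL = setS p.L p.R.S := by
    unfold Rule.fwdL setS
    rw [fwdL_σV hw ht hm, fwdL_σE hw ht hm]
  unfold Rule.fwd
  rw [this]

theorem onEdge_congr {f g : GMap V E} {G : Graph V E} (hG : G.WF)
    (h1 : ∀ v ∈ G.verts, f.onV v = g.onV v) (h2 : ∀ e ∈ G.edgeNames, f.onE e = g.onE e)
    {x} (hx : x ∈ G.edges) : f.onEdge x = g.onEdge x := by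
  unfold GMap.onEdge
  rw [h1 _ (hG.1 x hx).1, h1 _ (hG.1 x hx).2, h2 _ ⟨_, _, hx⟩]

theorem step_sub {p : Rule V E} (hm : p.Monotonic) {G H : Triple V E} {m n : TMap V E}
    (h : IsStep p G H m n) : G.S.Sub H.S := by
  obtain ⟨L, K, R⟩ := p
  cases hm
  obtain ⟨-, -, -, -, -, -, h, -⟩ := h
  rw [graphStep_iff] at h
  obtain ⟨-, -, -, -, h1, h2⟩ := h
  exact ⟨h1 ▸ Set.subset_union_left, h2 ▸ Set.subset_union_left⟩

theorem fwd_of_step {p : Rule V E} (hw : p.WF) (ht : p.TotalRule) (hm : p.Monotonic)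
    {G H : Triple V E} {m n : TMap V E} (h : IsStep p G H m n) {GS : Graph V E}
    (hGS : GS.WF) (hs : H.S.Sub GS) :
    IsStep p.fwd (setS G GS) (setS H GS) ⟨n.fS, m.fC, m.fT⟩ n := by
  have hsub := sub_trans (step_sub hm h) hs
  have hsub0 := step_sub hm h
  rw [fwd_eq hw ht hm]
  obtain ⟨L, K, R⟩ := p
  cases hm
  obtain ⟨hL, -, hR, -, hLR⟩ := hw
  obtain ⟨hG, hH, mh, mi, nh, ni, gS, gC, gT, rσV, rσE, rτV, rτE⟩ := h
  have gS' := graphStep_iff.1 gS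
  have gC' := graphStep_iff.1 gC
  have hCs : G.C.Sub H.C := ⟨gC'.2.2.2.2.1 ▸ Set.subset_union_left,
    gC'.2.2.2.2.2 ▸ Set.subset_union_left⟩
  refine ⟨⟨hGS, hG.2.1, hG.2.2.1, corr_mono hG.2.2.2.1 hsub, hG.2.2.2.2⟩,
    ⟨hGS, hH.2.1, hH.2.2.1, corr_mono hH.2.2.2.1 hs, hH.2.2.2.2⟩, ?_, ?_, ?_, ni, ?_, gC, gT,
    ?_, ?_, rτV, rτE⟩
  · refine ⟨⟨fun v hv => hs.1 (nh.1.1 v hv), fun x hx => hs.2 (nh.1.2 x hx)⟩, mh.2.1, mh.2.2.1,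
      fun q hq => ?_, fun q hq => ?_, mh.2.2.2.2.2⟩
    · have := mh.2.2.2.1 q hq
      rw [← gS'.1 _ (hL.2.2.2.1.1 q hq).2] at this
      exact this
    · have := mh.2.2.2.2.1 q hq
      rw [← gS'.2.1 _ (corr_cod hL.2.2.2.1 hq).2] at this
      exact this
  · exact ⟨ni.1, mi.2.1, mi.2.2⟩
  · exact ⟨⟨fun v hv => hs.1 (nh.1.1 v hv), fun x hx => hs.2 (nh.1.2 x hx)⟩, nh.2⟩
  · simp [GraphStep, setS]
  · rw [relStep_iff] at rσV ⊢
    · exact rσV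
    · exact fun q hq => ⟨hCs.1 (hG.2.2.2.1.1 q hq).1, hsub.1 (hG.2.2.2.1.1 q hq).2⟩
    · exact fun q hq => ⟨hCs.1 (hG.2.2.2.1.1 q hq).1, hsub0.1 (hG.2.2.2.1.1 q hq).2⟩
  · have key : ∀ S, G.S.Sub S → ∀ q ∈ G.σE, q.1 ∈ H.C.edgeNames ∧ q.2 ∈ S.edgeNames :=
      fun S hS q hq => ⟨names_mono hCs.2 (corr_cod hG.2.2.2.1 hq).1,
        names_mono hS.2 (corr_cod hG.2.2.2.1 hq).2⟩
    rw [relStep_iff] at rσE ⊢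
    · exact rσE
    · exact key _ hsub
    · exact key _ hsub0

theorem fwd_S {p : Rule V E} {X Y : Triple V E} {m n : TMap V E} (h : IsStep p.fwd X Y m n) :
    Y.S = X.S := by
  obtain ⟨-, -, -, -, -, -, h, -⟩ := h
  obtain ⟨-, -, -, -, h1, h2⟩ := h
  cases hX : X.S; cases hY : Y.S
  simp [Rule.fwd, Rule.fwdL, hX, hY] at h1 h2
  simp [h1, h2]

theorem step_of_fwd {p : Rule V E} (hw : p.WF) (ht : p.TotalRule) (hm : p.Monotonic)
    {X Y : Triple V E} {m n : TMap V E} (h : IsStep p.fwd X Y m n) {M M' : Graph V E}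
    (hV : M'.verts = M.verts ∪ markedV p m) (hE : M'.edges = M.edges ∪ markedE p m)
    (hM : M.Sub X.S) (hX : (setS X M).WF)
    (rV : requiredV p m ⊆ M.verts) (rE : requiredE p m ⊆ M.edges)
    (dV : ∀ v ∈ markedV p m, v ∉ M.verts) (dE : ∀ v ∈ markedE p m, v ∉ M.edges) :
    M'.Sub Y.S ∧ IsStep p (setS X M) (setS Y M') m n := by
  have hYX := fwd_S h
  rw [fwd_eq hw ht hm] at h
  obtain ⟨L, K, R⟩ := p
  cases hm
  obtain ⟨hL, -, hR, -, hLR⟩ := hw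
  obtain ⟨hG, hH, mh, mi, nh, ni, gS, gC, gT, rσV, rσE, rτV, rτE⟩ := h
  simp only [markedV, markedE, requiredV, requiredE] at *
  have eV : ∀ v ∈ R.S.verts, n.fS.onV v = m.fS.onV v := gS.1
  have eE : ∀ v ∈ R.S.edgeNames, n.fS.onE v = m.fS.onE v := gS.2.1
  have eEd : ∀ x ∈ R.S.edges, n.fS.onEdge x = m.fS.onEdge x :=
    fun x hx => onEdge_congr hR.1 eV eE hx
  have mV : ∀ v ∈ R.S.verts, m.fS.onV v ∈ M'.verts := by
    intro v hv
    rw [hV]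
    by_cases hl : v ∈ L.S.verts
    · exact Or.inl (rV ⟨v, hl, rfl⟩)
    · exact Or.inr ⟨v, ⟨hv, hl⟩, rfl⟩
  have mE : ∀ v ∈ R.S.edges, m.fS.onEdge v ∈ M'.edges := by
    intro v hv
    rw [hE]
    by_cases hl : v ∈ L.S.edges
    · exact Or.inl (rE ⟨v, hl, rfl⟩)
    · exact Or.inr ⟨v, ⟨hv, hl⟩, rfl⟩
  have hMM : M.Sub M' := ⟨hV ▸ Set.subset_union_left, hE ▸ Set.subset_union_left⟩
  have hM' : M'.Sub X.S := by
    constructor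
    · rw [hV]; rintro v (hv | ⟨v, hv, rfl⟩)
      · exact hM.1 hv
      · exact mh.1.1 v hv.1
    · rw [hE]; rintro v (hv | ⟨v, hv, rfl⟩)
      · exact hM.2 hv
      · exact mh.1.2 v hv.1
  have hM'W : M'.WF := by
    constructor
    · rw [hE]; rintro x (hx | ⟨x, hx, rfl⟩)
      · exact ⟨hMM.1 (hX.1.1 x hx).1, hMM.1 (hX.1.1 x hx).2⟩
      · exact ⟨mV _ (hR.1.1 x hx.1).1, mV _ (hR.1.1 x hx.1).2⟩
    · exact fun x hx y hy => hG.1.2 x (hM'.2 hx) y (hM'.2 hy)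
  have gC' := graphStep_iff.1 gC
  have hCs : X.C.Sub Y.C := ⟨gC'.2.2.2.2.1 ▸ Set.subset_union_left,
    gC'.2.2.2.2.2 ▸ Set.subset_union_left⟩
  have kV : ∀ S, M.Sub S → ∀ q ∈ X.σV, q.1 ∈ Y.C.verts ∧ q.2 ∈ S.verts :=
    fun S hS q hq => ⟨hCs.1 (hX.2.2.2.1.1 q hq).1, hS.1 (hX.2.2.2.1.1 q hq).2⟩
  have kE : ∀ S, M.Sub S → ∀ q ∈ X.σE, q.1 ∈ Y.C.edgeNames ∧ q.2 ∈ S.edgeNames :=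
    fun S hS q hq => ⟨names_mono hCs.2 (corr_cod hX.2.2.2.1 hq).1,
      names_mono hS.2 (corr_cod hX.2.2.2.1 hq).2⟩
  have rσV' := (relStep_iff (kV _ (hYX ▸ hM))).1 rσV
  have rσE' := (relStep_iff (kE _ (hYX ▸ hM))).1 rσE
  refine ⟨hYX ▸ hM', hX, ⟨hM'W, hH.2.1, hH.2.2.1, ?_, hH.2.2.2.2⟩, ?_, ?_, ?_, ni, ?_, gC, gT,
    (relStep_iff (kV _ hMM)).2 rσV', (relStep_iff (kE _ hMM)).2 rσE', rτV, rτE⟩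
  · obtain ⟨h1, h2, h3, h4, h5⟩ := hH.2.2.2.1
    refine ⟨fun q hq => ⟨(h1 q hq).1, ?_⟩, h2, h3, fun q hq u w hu => ?_, h5⟩
    · change q ∈ Y.σV at hq
      rw [rσV'] at hq
      rcases hq with hq | ⟨q, hq, rfl⟩
      · exact (kV _ hMM q hq).2
      · have := (hR.2.2.2.1.1 q hq.1).2
        change n.fS.onV q.2 ∈ _
        rw [eV _ this]; exact mV _ this
    · obtain ⟨u', w', a, b⟩ := h4 q hq u w hu
      refine ⟨u', w', ?_, b⟩
      have : q.2 ∈ M'.edgeNames := by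
        change q ∈ Y.σE at hq
        rw [rσE'] at hq
        rcases hq with hq | ⟨q, hq, rfl⟩
        · exact (kE _ hMM q hq).2
        · have := (corr_cod hR.2.2.2.1 hq.1).2
          change n.fS.onE q.2 ∈ _
          rw [eE _ this]
          obtain ⟨u, w, hu⟩ := this
          exact ⟨_, _, mE _ hu⟩
      obtain ⟨u2, w2, h2⟩ := this
      have h3 : (q.2, u2, w2) ∈ Y.S.edges := by rw [hYX]; exact hM'.2 h2
      have h4 : (q.2, u', w') = (q.2, u2, w2) := hH.1.2 _ a _ h3 rfl
      rw [h4]; exact h2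
  · exact ⟨⟨fun v hv => rV ⟨v, hv, rfl⟩, fun v hv => rE ⟨v, hv, rfl⟩⟩, mh.2⟩
  · exact ⟨⟨mi.1.1.mono hLR.1.1, mi.1.2.mono (names_mono hLR.1.2)⟩, mi.2⟩
  · exact ⟨⟨fun v hv => eV v hv ▸ mV v hv, fun v hv => eEd v hv ▸ mE v hv⟩, nh.2⟩
  · rw [graphStep_iff]
    refine ⟨fun v hv => eV v (hLR.1.1 hv), fun e he => eE e (names_mono hLR.1.2 he), ?_, ?_, ?_, ?_⟩
    · intro v hv
      rw [eV v hv.1]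
      exact dV _ ⟨v, hv, rfl⟩
    · rintro e ⟨⟨u, w, he⟩, hl⟩ ⟨u', w', h'⟩
      rw [eE e ⟨u, w, he⟩] at h'
      have h2 := hG.1.2 _ (hM.2 h') _ (mh.1.2 _ he) rfl
      refine dE (m.fS.onEdge (e, u, w)) ⟨_, ⟨he, fun hl' => hl ⟨_, _, hl'⟩⟩, rfl⟩ ?_
      rw [← h2]; exact h'
    · change M'.verts = M.verts ∪ _
      rw [hV]
      congr 1
      exact Set.image_congr fun v hv => (eV v hv.1).symm
    · change M'.edges = M.edges ∪ _
      rw [hE]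
      congr 1
      exact Set.image_congr fun v hv => (eEd v hv.1).symm

theorem seq_of_rtg {α : Type} {r : α → α → Prop} {a b : α} (h : Relation.ReflTransGen r a b) :
    ∃ (t : ℕ) (f : ℕ → α), f 0 = a ∧ f t = b ∧ ∀ i, i < t → r (f i) (f (i + 1)) := by
  induction h using Relation.ReflTransGen.head_induction_on with
  | refl => exact ⟨0, fun _ => b, rfl, rfl, by simp⟩
  | @head a c hac _ ih =>
    obtain ⟨t, f, h0, ht, hs⟩ := ih
    refine ⟨t + 1, fun i => Nat.casesOn i a f, rfl, ht, ?_⟩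
    rintro (_ | i) hi
    · simpa [h0] using hac
    · exact hs i (by omega)

theorem marked_desc {p : Rule V E} (hw : p.WF) (hm : p.Monotonic)
    {G H : Triple V E} {m n : TMap V E} (h : IsStep p G H m n) (m' : TMap V E)
    (hm' : m'.fS = n.fS) :
    markedV p m' = H.S.verts \ G.S.verts ∧ markedE p m' = H.S.edges \ G.S.edges ∧
    requiredV p m' ⊆ G.S.verts ∧ requiredE p m' ⊆ G.S.edges := by
  obtain ⟨L, K, R⟩ := p
  cases hm
  obtain ⟨hL, -, hR, -, hLR⟩ := hw
  obtain ⟨hG, hH, mh, mi, nh, ni, gS, -⟩ := h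
  obtain ⟨g1, g2, g3, g4, g5, g6⟩ := graphStep_iff.1 gS
  simp only [markedV, markedE, requiredV, requiredE, hm'] at *
  refine ⟨?_, ?_, ?_, ?_⟩
  · rw [g5, Set.union_sdiff_left, eq_comm, sdiff_eq_left, Set.disjoint_left]
    rintro _ ⟨v, hv, rfl⟩
    exact g3 v hv
  · rw [g6, Set.union_sdiff_left, eq_comm, sdiff_eq_left, Set.disjoint_left]
    rintro _ ⟨x, hx, rfl⟩ hc
    refine g4 x.1 ⟨⟨_, _, hx.1⟩, ?_⟩ ⟨_, _, hc⟩
    rintro ⟨u, w, hl⟩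
    have := hR.1.2 _ (hLR.1.2 hl) _ hx.1 rfl
    exact hx.2 (this ▸ hl)
  · rintro _ ⟨v, hv, rfl⟩
    beta_reduce; rw [g1 v hv]; exact mh.1.1 v hv
  · rintro _ ⟨v, hv, rfl⟩
    beta_reduce; rw [onEdge_congr hL.1 g1 g2 hv]; exact mh.1.2 v hv

theorem first_in {α : Type} {A : ℕ → Set α} (h0 : A 0 = ∅) (i : ℕ) :
    ∀ v ∈ A i, ∃ k, k < i ∧ v ∈ A (k + 1) \ A k := by
  induction i with
  | zero => simp [h0]
  | succ i ih =>
    intro v hv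
    by_cases h : v ∈ A i
    · obtain ⟨k, hk, h⟩ := ih v h
      exact ⟨k, by omega, h⟩
    · exact ⟨i, by omega, hv, h⟩

theorem chain_mono {α : Type} {A : ℕ → Set α} {t : ℕ} (h : ∀ i, i < t → A i ⊆ A (i + 1))
    {i j : ℕ} (hij : i ≤ j) (hj : j ≤ t) : A i ⊆ A j := by
  induction j, hij using Nat.le_induction with
  | base => rfl
  | succ j _ ih => exact (ih (by omega)).trans (h j (by omega))

theorem chain_disj {α : Type} {A : ℕ → Set α} {t : ℕ} (h : ∀ i, i < t → A i ⊆ A (i + 1))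
    {i j : ℕ} (hi : i < t) (hj : j < t) (hij : i ≠ j) :
    (A (i + 1) \ A i) ∩ (A (j + 1) \ A j) = ∅ := by
  ext v
  simp only [Set.mem_inter_iff, Set.mem_sdiff, Set.mem_empty_iff_false, iff_false]
  rintro ⟨⟨a, b⟩, c, d⟩
  rcases lt_or_gt_of_ne hij with hlt | hlt
  · exact d (chain_mono h hlt hj.le a)
  · exact b (chain_mono h hlt hi.le c)

/-- For a TGG with plain monotonic rules and the empty triple
graph as start graph, a triple graph `G = (G_S ← G_C → G_T)` belongs to the
language of the grammar if and only if there is a transformation sequence via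
forward rules of the grammar that starts at `(G_S ← ∅ → ∅)`, ends at `G`, and
is consistently and entirely marking. -/
theorem language_iff_consistently_and_entirely_marking_forward_sequence
    {V E : Type} (GG : TGG V E)
    (hmono : ∀ p ∈ GG.rules, p.Monotonic)
    (hWF : ∀ p ∈ GG.rules, p.WF)
    (htot : ∀ p ∈ GG.rules, p.TotalRule)
    (hstart : GG.start.IsEmptyTriple)
    (G : Triple V E) (hG : G.WF) (hGtot : G.Total) :
    G ∈ GG.lang ↔
      ∃ (t : ℕ) (Gs : ℕ → Triple V E) (ps : ℕ → Rule V E) (ms ns : ℕ → TMap V E),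
        (∀ i, i < t → ps i ∈ GG.rules) ∧
        FwdSequence t Gs ps ms ns ∧
        Gs 0 = G.srcOnly ∧
        Gs t = G ∧
        ConsistentlyMarking t ps ms ∧
        EntirelyMarking t ps ms G.S := by
  constructor
  · intro h
    obtain ⟨t, Hs, h0, hlast, hs⟩ := seq_of_rtg h
    choose! ps hps ms ns hst using hs
    have mV : ∀ i, i < t → (Hs i).S.verts ⊆ (Hs (i + 1)).S.verts :=
      fun i hi => (step_sub (hmono _ (hps i hi)) (hst i hi)).1
    have mE : ∀ i, i < t → (Hs i).S.edges ⊆ (Hs (i + 1)).S.edges :=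
      fun i hi => (step_sub (hmono _ (hps i hi)) (hst i hi)).2
    have hsub : ∀ i, i ≤ t → (Hs i).S.Sub G.S := fun i hi =>
      hlast ▸ ⟨chain_mono (A := fun i => (Hs i).S.verts) mV hi le_rfl,
        chain_mono (A := fun i => (Hs i).S.edges) mE hi le_rfl⟩
    have hd := fun i hi => marked_desc (hWF _ (hps i hi)) (hmono _ (hps i hi)) (hst i hi)
      ⟨(ns i).fS, (ms i).fC, (ms i).fT⟩ rfl
    obtain ⟨s1, s2, s3, s4, s5, s6, s7⟩ := hstart
    have e1 : (Hs 0).S.verts = ∅ := by rw [h0, s1]; rfl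
    have e2 : (Hs 0).S.edges = ∅ := by rw [h0, s1]; rfl
    refine ⟨t, fun i => setS (Hs i) G.S, ps, fun i => ⟨(ns i).fS, (ms i).fC, (ms i).fT⟩, ns,
      hps, ?_, ?_, ?_, ⟨?_, ?_⟩, ?_, ?_⟩
    · exact fun i hi => fwd_of_step (hWF _ (hps i hi)) (htot _ (hps i hi)) (hmono _ (hps i hi))
        (hst i hi) hG.1 (hsub _ hi)
    · simp [h0, setS, Triple.srcOnly, s2, s3, s4, s5, s6, s7]
    · simp [hlast, setS]
    · intro i j hi hj hij
      simp only [hd i hi, hd j hj]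
      exact ⟨chain_disj (A := fun i => (Hs i).S.verts) mV hi hj hij,
        chain_disj (A := fun i => (Hs i).S.edges) mE hi hj hij⟩
    · intro i hi
      constructor
      · intro v hv
        obtain ⟨k, hk, h⟩ := first_in (A := fun i => (Hs i).S.verts) e1 i v ((hd i hi).2.2.1 hv)
        exact ⟨k, hk, by rw [(hd k (hk.trans hi)).1]; exact h⟩
      · intro v hv
        obtain ⟨k, hk, h⟩ := first_in (A := fun i => (Hs i).S.edges) e2 i v ((hd i hi).2.2.2 hv)
        exact ⟨k, hk, by rw [(hd k (hk.trans hi)).2.1]; exact h⟩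
    · intro v hv
      obtain ⟨k, hk, h⟩ := first_in (A := fun i => (Hs i).S.verts) e1 t v (by simpa [hlast] using hv)
      exact ⟨k, hk, by rw [(hd k hk).1]; exact h⟩
    · intro v hv
      obtain ⟨k, hk, h⟩ := first_in (A := fun i => (Hs i).S.edges) e2 t v (by simpa [hlast] using hv)
      exact ⟨k, hk, by rw [(hd k hk).2.1]; exact h⟩
  · rintro ⟨t, Gs, ps, ms, ns, hps, hseq, h0, hlast, ⟨hcr, hctx⟩, hentV, hentE⟩
    let M : ℕ → Graph V E := fun i =>
      ⟨{v | ∃ k, k < i ∧ v ∈ markedV (ps k) (ms k)}, {v | ∃ k, k < i ∧ v ∈ markedE (ps k) (ms k)}⟩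
    have hst : GG.start = setS (Gs 0) (M 0) := by
      obtain ⟨s1, s2, s3, s4, s5, s6, s7⟩ := hstart
      have : M 0 = Graph.emptyG V E := by simp [M, Graph.emptyG]
      rw [this, h0]
      cases hS : GG.start
      simp_all [setS, Triple.srcOnly]
    have hwf0 : (setS (Gs 0) (M 0)).WF := by
      rw [h0]
      simp [M, setS, Triple.srcOnly, Triple.WF, Graph.WF, Triple.CorrWF, Graph.emptyG]
    have key : ∀ i, i ≤ t → (M i).Sub (Gs i).S ∧ (setS (Gs i) (M i)).WF ∧ (Gs i).S = G.S ∧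
        setS (Gs i) (M i) ∈ GG.lang := by
      intro i
      induction i with
      | zero =>
        intro _
        refine ⟨by simp [M, Graph.Sub], hwf0, by rw [h0]; rfl, ?_⟩
        rw [← hst]; exact Relation.ReflTransGen.refl
      | succ i ih =>
        intro hi
        obtain ⟨i1, i2, i3, i4⟩ := ih (by omega)
        have hp := hps i hi
        have hs := hseq i hi
        have := step_of_fwd (hWF _ hp) (htot _ hp) (hmono _ hp) hs (M := M i) (M' := M (i + 1))
          (by ext v; simp [M, Order.lt_add_one_iff, le_iff_lt_or_eq, or_and_right, exists_or])
          (by ext v; simp [M, Order.lt_add_one_iff, le_iff_lt_or_eq, or_and_right, exists_or])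
          i1 i2 (hctx i hi).1 (hctx i hi).2
          (by
            rintro v hv ⟨k, hk, hv'⟩
            exact (Set.eq_empty_iff_forall_notMem.1
              (hcr i k hi (hk.trans hi) hk.ne').1) v ⟨hv, hv'⟩)
          (by
            rintro v hv ⟨k, hk, hv'⟩
            exact (Set.eq_empty_iff_forall_notMem.1
              (hcr i k hi (hk.trans hi) hk.ne').2) v ⟨hv, hv'⟩)
        exact ⟨this.1, this.2.2.1, (fwd_S hs).trans i3,
          Relation.ReflTransGen.tail i4 ⟨_, hp, _, _, this.2⟩⟩
    obtain ⟨k1, -, -, k4⟩ := key t le_rfl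
    have hMt : M t = G.S := by
      rw [hlast] at k1
      have a : (M t).verts = G.S.verts := Set.Subset.antisymm k1.1 hentV
      have b : (M t).edges = G.S.edges := Set.Subset.antisymm k1.2 hentE
      cases hS : G.S
      simp_all [M]
    rw [hMt, hlast] at k4
    exact k4
end TGGPaper
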